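/- Let n ≥ 2, let c ∈ ℤ[x_1,…,x_{n−1}] be nonzero, and let F_1,…,F_t ∈ ℤ[x_1,…,x_n] be pairwise relatively prime polynomials of positive degree in x_n. Set F = c·F_1⋯F_t and let δ ≥ 1 be the degree of F in x_n. Then res_{x_n}(F, ∂F/∂x_n) = ± c^{2δ−1} · ∏_{j=1}^t ldcf(F_j) · ∏_{j=1}^t disc(F_j) · ∏_{1 ≤ j < k ≤ t} res_{x_n}(F_j,F_k)². Consequently, if F has degree at most d in every variable, then the set {c} ∪ {ldcf(F_j) : j} ∪ {disc(F_j) : j} ∪ {res_{x_n}(F_j,F_k) : j < k} has combined degree at most 2d². -/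

import Mathlib

open Polynomial
open scoped Classical

noncomputable section

/-- `Rk k` is the coefficient ring `ℤ[x_1,…,x_{n-1}]` (with `k = n - 1`);
polynomials in `ℤ[x_1,…,x_n]` are regarded as elements of `Polynomial (Rk k)`,
univariate in `x_n`. -/
abbrev Rk (k : ℕ) : Type := MvPolynomial (Fin k) ℤ

/-- The degree of `P ∈ ℤ[x_1,…,x_n]` in the variable `x_i`, `i ≤ n-1`. -/
def degX {k : ℕ} (P : Polynomial (Rk k)) (i : Fin k) : ℕ :=
  P.support.sup fun j => (P.coeff j).degreeOf i

/-- The combined degree of the finite set `S ⊆ ℤ[x_1,…,x_n]` (the maximum over all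
variables of the degree of the product of the elements of `S`) is at most `d`. -/
def combDegLE {k : ℕ} (S : Finset (Polynomial (Rk k))) (d : ℕ) : Prop :=
  (S.prod id).natDegree ≤ d ∧ ∀ i : Fin k, degX (S.prod id) i ≤ d

/-- The `(m,d)`-property for finite sets of polynomials in `ℤ[x_1,…,x_n]`:
the set can be partitioned into at most `m` subsets, each of combined degree at most `d`. -/
def HasMD {k : ℕ} (m d : ℕ) (A : Finset (Polynomial (Rk k))) : Prop :=
  ∃ Part : Finset (Finset (Polynomial (Rk k))),
    Part.card ≤ m ∧ (∀ S ∈ Part, ∀ T ∈ Part, S ≠ T → Disjoint S T) ∧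
    Part.sup id = A ∧ ∀ S ∈ Part, combDegLE S d

/-- Combined degree at most `d` for finite sets of polynomials in `ℤ[x_1,…,x_{n-1}]`. -/
def mvCombDegLE {k : ℕ} (S : Finset (Rk k)) (d : ℕ) : Prop :=
  ∀ i : Fin k, (S.prod id).degreeOf i ≤ d

/-- The `(m,d)`-property for finite sets of polynomials in `ℤ[x_1,…,x_{n-1}]`. -/
def mvHasMD {k : ℕ} (m d : ℕ) (A : Finset (Rk k)) : Prop :=
  ∃ Part : Finset (Finset (Rk k)),
    Part.card ≤ m ∧ (∀ S ∈ Part, ∀ T ∈ Part, S ≠ T → Disjoint S T) ∧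
    Part.sup id = A ∧ ∀ S ∈ Part, mvCombDegLE S d

/-- The Sylvester matrix of `f` and `g` with respect to `x_n`. -/
def sylvesterMat {k : ℕ} (f g : Polynomial (Rk k)) :
    Matrix (Fin (g.natDegree + f.natDegree)) (Fin (g.natDegree + f.natDegree)) (Rk k) :=
  Matrix.of fun i j =>
    if (i : ℕ) < g.natDegree then
      (if (i : ℕ) ≤ (j : ℕ) ∧ (j : ℕ) ≤ (i : ℕ) + f.natDegree then
        f.coeff (f.natDegree + (i : ℕ) - (j : ℕ)) else 0)
    else
      (if (i : ℕ) - g.natDegree ≤ (j : ℕ) ∧ (j : ℕ) ≤ (i : ℕ) then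
        g.coeff ((i : ℕ) - (j : ℕ)) else 0)

/-- The resultant `res_{x_n}(f,g)`, the determinant of the Sylvester matrix. -/
def resX {k : ℕ} (f g : Polynomial (Rk k)) : Rk k := (sylvesterMat f g).det

/-- The discriminant of `f` (of degree `δ ≥ 1` in `x_n`): the element `D` satisfying
`ldcf(f) * D = (-1)^(δ(δ-1)/2) * res_{x_n}(f, f')`. -/
def discX {k : ℕ} (f : Polynomial (Rk k)) : Rk k :=
  if h : ∃ D : Rk k, f.leadingCoeff * D =
      (-1 : Rk k) ^ (f.natDegree * (f.natDegree - 1) / 2) * resX f (derivative f)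
  then h.choose else 0

/-- A choice of content and primitive part of `f` over `Rk k`. -/
def contPair {k : ℕ} (f : Polynomial (Rk k)) : Rk k × Polynomial (Rk k) :=
  if h : ∃ p : Rk k × Polynomial (Rk k), f = Polynomial.C p.1 * p.2 ∧ p.2.IsPrimitive
  then h.choose else (0, 0)

/-- The content of `f` over `Rk k` (determined up to sign). -/
def contX {k : ℕ} (f : Polynomial (Rk k)) : Rk k := (contPair f).1

/-- The primitive part of `f` over `Rk k` (determined up to sign). -/
def primX {k : ℕ} (f : Polynomial (Rk k)) : Polynomial (Rk k) := (contPair f).2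

/-- An irreducible basis: a finite set of irreducible polynomials of positive degree
in `x_n` that are pairwise relatively prime. -/
def IsIrredBasis {k : ℕ} (B : Finset (Polynomial (Rk k))) : Prop :=
  (∀ b ∈ B, 0 < b.natDegree ∧ Irreducible b) ∧
  ∀ b ∈ B, ∀ b' ∈ B, b ≠ b' → IsRelPrime b b'

/-- `B` is an irreducible basis for the primitive parts of `A`: an irreducible basis,
each element of which divides some element of `A`, such that the primitive part of each
element of `A` of positive degree in `x_n` is, up to sign, a product of powers of
elements of `B`. -/
def IsBasisForPrim {k : ℕ} (B A : Finset (Polynomial (Rk k))) : Prop :=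
  IsIrredBasis B ∧ (∀ b ∈ B, ∃ a ∈ A, b ∣ a) ∧
  ∀ a ∈ A, 0 < a.natDegree →
    ∃ e : Polynomial (Rk k) → ℕ,
      primX a = ∏ b ∈ B, b ^ e b ∨ primX a = -∏ b ∈ B, b ^ e b

/-- The (nonzero) `x_n`-coefficients of `f`, as a finite set. -/
def coeffFinset {k : ℕ} (f : Polynomial (Rk k)) : Finset (Rk k) := f.support.image f.coeff

/-- `coeff(B)`: all `x_n`-coefficients of elements of `B`. -/
def coeffsB {k : ℕ} (B : Finset (Polynomial (Rk k))) : Finset (Rk k) := B.biUnion coeffFinset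

/-- `disc(B)`. -/
def discB {k : ℕ} (B : Finset (Polynomial (Rk k))) : Finset (Rk k) := B.image discX

/-- `res(B) = {res(f,g) : f ≠ g ∈ B}`. -/
def resB {k : ℕ} (B : Finset (Polynomial (Rk k))) : Finset (Rk k) :=
  ((B ×ˢ B).filter fun p => p.1 ≠ p.2).image fun p => resX p.1 p.2

/-- `cont(A)`. -/
def contA {k : ℕ} (A : Finset (Polynomial (Rk k))) : Finset (Rk k) := A.image contX

/-- `P(B) = coeff(B) ∪ disc(B) ∪ res(B)`. -/
def projP {k : ℕ} (B : Finset (Polynomial (Rk k))) : Finset (Rk k) :=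
  coeffsB B ∪ discB B ∪ resB B

/-- `{res(f,g) : f ∈ F, g ∈ G}`. -/
def crossRes {k : ℕ} (F G : Finset (Polynomial (Rk k))) : Finset (Rk k) :=
  (F ×ˢ G).image fun p => resX p.1 p.2

/-- The cross resultant set `RES×(𝓕)`. -/
def RESx {k t : ℕ} (F : Fin t → Finset (Polynomial (Rk k))) : Finset (Rk k) :=
  ((Finset.univ : Finset (Fin t × Fin t)).filter fun p => p.1 < p.2).biUnion fun p =>
    ((F p.1 ×ˢ F p.2).filter fun q => q.1 ≠ q.2).image fun q => resX q.1 q.2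

/-- The TTICAD projection `P_𝓔(𝓐) = ⋃ᵢ cont(Aᵢ) ∪ ⋃ᵢ P_{Fᵢ}(Bᵢ) ∪ RES×(𝓕)`. -/
def ttiProj {k t : ℕ} (A B F : Fin t → Finset (Polynomial (Rk k))) : Finset (Rk k) :=
  (Finset.univ.biUnion fun i => contA (A i)) ∪
    (Finset.univ.biUnion fun i => projP (F i) ∪ crossRes (F i) (B i \ F i)) ∪
    RESx F


lemma resX_eq_resultant {k : ℕ} (f g : Polynomial (Rk k)) : resX f g = f.resultant g := by
  let e : Fin (g.natDegree + f.natDegree) ≃ Fin (f.natDegree + g.natDegree) :=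
    Fin.revPerm.trans (finCongr (add_comm _ _))
  have h : sylvesterMat f g =
      ((f.sylvester g f.natDegree g.natDegree).submatrix e e).transpose := by
    ext1 i j
    have hi := i.2
    have hj := j.2
    rcases lt_or_ge (i : ℕ) g.natDegree with h | h
    · have he : e i = Fin.natAdd f.natDegree ⟨g.natDegree - 1 - i, by omega⟩ := by
        ext; simp [e]; omega
      simp only [sylvesterMat, Matrix.of_apply, Matrix.transpose_apply, Matrix.submatrix_apply,
        sylvester, he, Fin.addCases_right, Set.mem_Icc, h, if_true]
      have hj' : (e j : ℕ) = g.natDegree + f.natDegree - (j + 1) := by simp [e]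
      rw [hj']
      congr 1
      · apply propext; omega
      · congr 1; omega
    · have he : e i = Fin.castAdd g.natDegree ⟨g.natDegree + f.natDegree - (i + 1), by omega⟩ := by
        ext; simp [e]
      simp only [sylvesterMat, Matrix.of_apply, Matrix.transpose_apply, Matrix.submatrix_apply,
        sylvester, he, Fin.addCases_left, Set.mem_Icc, h.not_gt, if_false]
      have hj' : (e j : ℕ) = g.natDegree + f.natDegree - (j + 1) := by simp [e]
      rw [hj']
      congr 1
      · apply propext; omega
      · congr 1; omega
  rw [resX, h, Matrix.det_transpose, Matrix.det_submatrix_equiv_self, resultant]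

section Domain

variable {R : Type*} [CommRing R] [IsDomain R] [CharZero R]

lemma resultant_derivative_eq {f : R[X]} (hf : 0 < f.natDegree) :
    f.resultant (derivative f) =
      (-1) ^ (f.natDegree * (f.natDegree - 1) / 2) * f.leadingCoeff * f.discr := by
  rw [natDegree_derivative]
  exact resultant_deriv (natDegree_pos_iff_degree_pos.mp hf)

lemma resultant_derivative_mul {f g : R[X]} (hf : 0 < f.natDegree) (hg : g ≠ 0) :
    f.resultant (derivative (f * g)) f.natDegree ((f * g).natDegree - 1) =
      f.resultant (derivative f) * f.resultant g := by
  have hf0 : f ≠ 0 := by rintro rfl; simp at hf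
  have hdeg : (f * g).natDegree - 1 = (derivative f).natDegree + g.natDegree := by
    rw [natDegree_derivative, natDegree_mul hf0 hg]; omega
  rw [hdeg, ← resultant_mul_right _ _ _ _ le_rfl, derivative_mul]
  rcases Nat.eq_zero_or_pos g.natDegree with h | h
  · rw [derivative_of_natDegree_zero h, mul_zero, add_zero]
  · refine resultant_add_mul_right _ _ _ _ _ ?_ le_rfl
    rw [natDegree_derivative, natDegree_derivative]
    omega

lemma resultant_prod_derivative {ι : Type*} [Fintype ι] [DecidableEq ι] (F : ι → R[X])
    (hF : ∀ j, 0 < (F j).natDegree) :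
    (∏ j, F j).resultant (derivative (∏ j, F j)) =
      (∏ j, (F j).resultant (derivative (F j))) *
        ∏ j, ∏ i ∈ ({j}ᶜ : Finset ι), (F j).resultant (F i) := by
  have hF0 : ∀ j, F j ≠ 0 := fun j h => by simpa [h] using hF j
  rw [resultant_prod_left _ _ _ _
      (Finset.prod_ne_zero_iff.mpr fun j _ => leadingCoeff_ne_zero.mpr (hF0 j)) le_rfl,
    ← Finset.prod_mul_distrib]
  refine Finset.prod_congr rfl fun j _ => ?_
  rw [← resultant_prod_right _ _ _ _ le_rfl
      (Finset.prod_ne_zero_iff.mpr fun i _ => leadingCoeff_ne_zero.mpr (hF0 i)),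
    ← resultant_derivative_mul (hF j) (Finset.prod_ne_zero_iff.mpr fun i _ => hF0 i),
    Fintype.prod_eq_mul_prod_compl j, natDegree_derivative]

lemma resultant_C_mul_derivative {c : R} (hc : c ≠ 0) {f : R[X]} (hf : 0 < f.natDegree) :
    (C c * f).resultant (derivative (C c * f)) =
      c ^ (2 * f.natDegree - 1) * f.resultant (derivative f) := by
  rw [derivative_C_mul, natDegree_C_mul hc, natDegree_C_mul hc, resultant_C_mul_left,
    resultant_C_mul_right, ← mul_assoc, ← pow_add, natDegree_derivative]
  congr 2
  omega

end Domain

lemma discX_eq_discr {k : ℕ} {f : Polynomial (Rk k)} (hf : 0 < f.natDegree) :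
    discX f = f.discr := by
  have hf0 : f.leadingCoeff ≠ 0 := leadingCoeff_ne_zero.mpr (by rintro rfl; simp at hf)
  have h : f.leadingCoeff * f.discr =
      (-1 : Rk k) ^ (f.natDegree * (f.natDegree - 1) / 2) * resX f (derivative f) := by
    rw [resX_eq_resultant, resultant_derivative_eq hf, ← mul_assoc, ← mul_assoc, ← pow_add,
      Even.neg_one_pow ⟨_, rfl⟩, one_mul]
  have hex : ∃ D : Rk k, f.leadingCoeff * D =
      (-1 : Rk k) ^ (f.natDegree * (f.natDegree - 1) / 2) * resX f (derivative f) := ⟨_, h⟩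
  rw [discX, dif_pos hex]
  exact mul_left_cancel₀ hf0 (hex.choose_spec.trans h.symm)

/-- The product of the resultants over all ordered pairs of distinct indices is, up to sign,
the product of the squared resultants over the increasing pairs. -/
lemma exists_prod_resultant_compl_eq {R : Type*} [CommRing R] {ι : Type*} [Fintype ι]
    [LinearOrder ι] [LocallyFiniteOrderTop ι] [LocallyFiniteOrderBot ι] (F : ι → R[X]) :
    ∃ e : ℕ, ∏ j, ∏ i ∈ ({j}ᶜ : Finset ι), (F j).resultant (F i) =
      (-1) ^ e * ∏ p ∈ (Finset.univ : Finset (ι × ι)).filter fun p => p.1 < p.2,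
        (F p.1).resultant (F p.2) ^ 2 := by
  refine ⟨∑ p ∈ (Finset.univ : Finset (ι × ι)).filter fun p => p.1 < p.2,
    (F p.1).natDegree * (F p.2).natDegree, ?_⟩
  rw [← Finset.prod_prod_Ioi_mul_eq_prod_prod_off_diag fun i j => (F j).resultant (F i),
    ← Finset.prod_pow_eq_pow_sum, ← Finset.prod_mul_distrib, Finset.prod_filter,
    Fintype.prod_prod_type]
  refine Finset.prod_congr rfl fun i _ => ?_
  rw [← Finset.prod_filter, Finset.filter_lt_eq_Ioi]
  refine Finset.prod_congr rfl fun j _ => ?_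
  rw [resultant_comm (F j) (F i), mul_comm (F j).natDegree]
  ring

lemma exists_resX_derivative_eq {k t : ℕ} {c : Rk k} (hc : c ≠ 0)
    {F : Fin t → Polynomial (Rk k)} (hF : ∀ j, 0 < (F j).natDegree)
    (hδ : 1 ≤ (C c * ∏ j, F j).natDegree) :
    ∃ e : ℕ, resX (C c * ∏ j, F j) (derivative (C c * ∏ j, F j)) =
      (-1) ^ e * (c ^ (2 * (C c * ∏ j, F j).natDegree - 1) *
        (∏ j, (F j).leadingCoeff) * (∏ j, discX (F j)) *
        ∏ p ∈ (Finset.univ : Finset (Fin t × Fin t)).filter fun p => p.1 < p.2,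
          resX (F p.1) (F p.2) ^ 2) := by
  obtain ⟨e, he⟩ := exists_prod_resultant_compl_eq F
  simp only [resX_eq_resultant, discX_eq_discr (hF _)]
  rw [natDegree_C_mul hc] at hδ
  refine ⟨e + ∑ j, (F j).natDegree * ((F j).natDegree - 1) / 2, ?_⟩
  rw [resultant_C_mul_derivative hc hδ, natDegree_C_mul hc, resultant_prod_derivative F hF, he]
  simp only [resultant_derivative_eq (hF _), Finset.prod_mul_distrib, pow_add,
    Finset.prod_pow_eq_pow_sum]
  ring

lemma degreeOf_det_le {σ ι R : Type*} [CommRing R] [Fintype ι] [DecidableEq ι]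
    {M : Matrix ι ι (MvPolynomial σ R)} {i : σ} {d : ℕ} (hM : ∀ a b, (M a b).degreeOf i ≤ d) :
    M.det.degreeOf i ≤ Fintype.card ι * d := by
  rw [Matrix.det_apply]
  refine (MvPolynomial.degreeOf_sum_le _ _ _).trans (Finset.sup_le fun s _ => ?_)
  have h : (∏ a, M (s a) a).degreeOf i ≤ Fintype.card ι * d :=
    (MvPolynomial.degreeOf_prod_le _ _ _).trans <|
      (Finset.sum_le_sum fun a _ => hM (s a) a).trans (by simp)
  rcases Int.units_eq_one_or (Equiv.Perm.sign s) with hs | hs <;> rw [hs]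
  · simpa using h
  · simpa [MvPolynomial.degreeOf_neg] using h

lemma degreeOf_le_of_dvd {σ R : Type*} [CommRing R] [IsDomain R] {p q : MvPolynomial σ R}
    (h : p ∣ q) (hq : q ≠ 0) (i : σ) : p.degreeOf i ≤ q.degreeOf i := by
  obtain ⟨r, rfl⟩ := h
  rw [MvPolynomial.degreeOf_mul_eq (left_ne_zero_of_mul hq) (right_ne_zero_of_mul hq)]
  exact Nat.le_add_right _ _

lemma degreeOf_coeff_le_degX {k : ℕ} (P : Polynomial (Rk k)) (i : Fin k) (j : ℕ) :
    (P.coeff j).degreeOf i ≤ degX P i := by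
  by_cases h : j ∈ P.support
  · exact Finset.le_sup (f := fun j => (P.coeff j).degreeOf i) h
  · simp [notMem_support_iff.mp h]

lemma degreeOf_coeff_derivative_le_degX {k : ℕ} (P : Polynomial (Rk k)) (i : Fin k) (j : ℕ) :
    ((derivative P).coeff j).degreeOf i ≤ degX P i := by
  rw [coeff_derivative]
  have h : ((j : Rk k) + 1) = MvPolynomial.C ((j : ℤ) + 1) := by simp
  rw [h]
  exact (MvPolynomial.degreeOf_mul_C_le _ _ _).trans (degreeOf_coeff_le_degX P i _)

lemma degreeOf_resX_le {k : ℕ} {f g : Polynomial (Rk k)} {i : Fin k} {d : ℕ}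
    (hf : ∀ j, (f.coeff j).degreeOf i ≤ d) (hg : ∀ j, (g.coeff j).degreeOf i ≤ d) :
    (resX f g).degreeOf i ≤ (g.natDegree + f.natDegree) * d := by
  have h := degreeOf_det_le (M := sylvesterMat f g) (i := i) (d := d) fun a b => by
    simp only [sylvesterMat, Matrix.of_apply]
    split_ifs <;> simp [hf, hg]
  rwa [Fintype.card_fin] at h

lemma prod_union_dvd {α M : Type*} [DecidableEq α] [CommMonoid M] (s t : Finset α) (f : α → M) :
    (s ∪ t).prod f ∣ s.prod f * t.prod f :=
  ⟨(s ∩ t).prod f, (Finset.prod_union_inter).symm⟩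

lemma prod_image_dvd {ι M : Type*} [DecidableEq M] [CommMonoid M] (s : Finset ι) (f : ι → M) :
    (s.image f).prod id ∣ s.prod f := by
  rw [← Finset.prod_fiberwise_of_maps_to (g := f) (t := s.image f)
    fun i hi => Finset.mem_image_of_mem f hi]
  refine Finset.prod_dvd_prod_of_dvd _ _ fun b hb => ?_
  obtain ⟨i, hi, rfl⟩ := Finset.mem_image.mp hb
  exact Finset.dvd_prod_of_mem f (Finset.mem_filter.mpr ⟨hi, rfl⟩)

/-- Let `c ∈ ℤ[x_1,…,x_{n-1}]` be nonzero and `F_1,…,F_t` pairwise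
relatively prime polynomials of positive degree in `x_n`.  Set `F = c·F_1⋯F_t`, of
degree `δ ≥ 1` in `x_n`.  Then
`res(F, F') = ± c^{2δ−1} · ∏ⱼ ldcf(Fⱼ) · ∏ⱼ disc(Fⱼ) · ∏_{j<k} res(Fⱼ,F_k)²`,
and consequently, if `F` has degree at most `d` in every variable, then the set
`{c} ∪ {ldcf(Fⱼ)} ∪ {disc(Fⱼ)} ∪ {res(Fⱼ,F_k) : j < k}` has combined degree
at most `2d²`. -/
theorem resultant_of_product_formula
    (k t : ℕ) (hk : 1 ≤ k) (ht : 0 < t)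
    (c : Rk k) (hc : c ≠ 0)
    (F : Fin t → Polynomial (Rk k))
    (hFdeg : ∀ j, 0 < (F j).natDegree)
    (hFrel : ∀ j j', j ≠ j' → IsRelPrime (F j) (F j'))
    (hδ : 1 ≤ (Polynomial.C c * ∏ j, F j).natDegree) :
    (resX (Polynomial.C c * ∏ j, F j) (derivative (Polynomial.C c * ∏ j, F j)) =
        c ^ (2 * (Polynomial.C c * ∏ j, F j).natDegree - 1) *
          (∏ j, (F j).leadingCoeff) * (∏ j, discX (F j)) *
          ∏ p ∈ (Finset.univ : Finset (Fin t × Fin t)).filter fun p => p.1 < p.2,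
            resX (F p.1) (F p.2) ^ 2 ∨
      resX (Polynomial.C c * ∏ j, F j) (derivative (Polynomial.C c * ∏ j, F j)) =
        -(c ^ (2 * (Polynomial.C c * ∏ j, F j).natDegree - 1) *
          (∏ j, (F j).leadingCoeff) * (∏ j, discX (F j)) *
          ∏ p ∈ (Finset.univ : Finset (Fin t × Fin t)).filter fun p => p.1 < p.2,
            resX (F p.1) (F p.2) ^ 2)) ∧
    ∀ d : ℕ, (Polynomial.C c * ∏ j, F j).natDegree ≤ d →
      (∀ i : Fin k, degX (Polynomial.C c * ∏ j, F j) i ≤ d) →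
      mvCombDegLE
        ({c} ∪ Finset.univ.image (fun j => (F j).leadingCoeff) ∪
          Finset.univ.image (fun j => discX (F j)) ∪
          ((Finset.univ : Finset (Fin t × Fin t)).filter fun p => p.1 < p.2).image
            (fun p => resX (F p.1) (F p.2)))
        (2 * d ^ 2) := by
  obtain ⟨e, he⟩ := exists_resX_derivative_eq hc hFdeg hδ
  refine ⟨?_, fun d hd hdX i => ?_⟩
  · rw [he]
    rcases neg_one_pow_eq_or (Rk k) e with h | h <;> rw [h]
    · exact Or.inl (one_mul _)
    · exact Or.inr (neg_one_mul _)
  set S : Finset (Rk k) := {c} ∪ Finset.univ.image (fun j => (F j).leadingCoeff) ∪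
    Finset.univ.image (fun j => discX (F j)) ∪
    ((Finset.univ : Finset (Fin t × Fin t)).filter fun p => p.1 < p.2).image
      (fun p => resX (F p.1) (F p.2)) with hS
  by_cases h0 : S.prod id = 0
  · rw [h0, MvPolynomial.degreeOf_zero]
    exact Nat.zero_le _
  have hne : ∀ x ∈ S, x ≠ 0 := Finset.prod_ne_zero_iff.mp h0
  have hdvd : S.prod id ∣ resX (C c * ∏ j, F j) (derivative (C c * ∏ j, F j)) := by
    rw [he]
    refine Dvd.dvd.mul_left ?_ _
    refine (prod_union_dvd _ _ _).trans (mul_dvd_mul ?_ ?_)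
    · refine (prod_union_dvd _ _ _).trans (mul_dvd_mul ?_ (prod_image_dvd _ _))
      refine (prod_union_dvd _ _ _).trans (mul_dvd_mul ?_ (prod_image_dvd _ _))
      simpa using dvd_pow_self c (by omega)
    · exact (prod_image_dvd _ _).trans
        (Finset.prod_dvd_prod_of_dvd _ _ fun p _ => dvd_pow_self _ two_ne_zero)
  have hres : resX (C c * ∏ j, F j) (derivative (C c * ∏ j, F j)) ≠ 0 := by
    rw [he]
    refine mul_ne_zero (by simp)
      (mul_ne_zero (mul_ne_zero (mul_ne_zero (pow_ne_zero _ hc) ?_) ?_) ?_)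
    · exact Finset.prod_ne_zero_iff.mpr fun j _ => hne _ (by simp [hS])
    · exact Finset.prod_ne_zero_iff.mpr fun j _ => hne _ (by simp [hS])
    · refine Finset.prod_ne_zero_iff.mpr fun p hp => pow_ne_zero _ (hne _ ?_)
      exact Finset.mem_union_right _ (Finset.mem_image_of_mem _ hp)
  calc (S.prod id).degreeOf i
      ≤ _ := degreeOf_le_of_dvd hdvd hres i
    _ ≤ _ := degreeOf_resX_le (d := d)
        (fun j => (degreeOf_coeff_le_degX _ i j).trans (hdX i))
        (fun j => (degreeOf_coeff_derivative_le_degX _ i j).trans (hdX i))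
    _ ≤ (d + d) * d := by
        rw [natDegree_derivative]
        gcongr
        omega
    _ = 2 * d ^ 2 := by ring

end
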